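/- Let c = (c_{i,j}) be a non-zero frieze pattern of height n over the set of real numbers x with |x| > 1/√2. Then all entries of the quiddity sequence have the same sign: for all i, i' ∈ ℤ, the entries c_{i,i+2} and c_{i',i'+2} are either both positive or both negative. -/

import Mathlib

/-- A non-zero frieze pattern of height `n` over a subset `R` of a field `K`. -/
def IsFrieze {K : Type*} [Field K] (R : Set K) (n : ℕ) (c : ℤ → ℤ → K) : Prop :=
  (∀ i : ℤ, c i i = 0 ∧ c i (i + 1) = 1 ∧
      c i ((n : ℤ) + i + 2) = 1 ∧ c i ((n : ℤ) + i + 3) = 0) ∧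
  (∀ i j : ℤ, i + 1 ≤ j → j ≤ (n : ℤ) + i + 2 → c i j ∈ R ∧ c i j ≠ 0) ∧
  (∀ i j : ℤ, i + 1 ≤ j → j ≤ (n : ℤ) + i + 2 →
    c i j * c (i + 1) (j + 1) - c i (j + 1) * c (i + 1) j = 1)

/-- Consecutive columns of a non-zero frieze pattern satisfy the three-term recurrence whose
coefficient is a quiddity entry. -/
theorem IsFrieze.add_eq_quiddity_mul {K : Type*} [Field K] {R : Set K} {n : ℕ} {c : ℤ → ℤ → K}
    (hc : IsFrieze R n c) (j : ℤ) (m : ℕ) (hm : m ≤ n + 1) :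
    c (j - 1 - m) (j - 1) + c (j - 1 - m) (j + 1) = c (j - 1) (j + 1) * c (j - 1 - m) j := by
  obtain ⟨hb, hR, hd⟩ := hc
  induction m with
  | zero =>
    have h0 := (hb (j - 1)).1
    have h1 := (hb (j - 1)).2.1
    rw [show j - 1 + 1 = j by ring] at h1
    simp [h0, h1]
  | succ m ih =>
    have ih := ih (by lia)
    obtain ⟨k, hk⟩ : ∃ k : ℤ, k = j - 1 - (m + 1 : ℕ) := ⟨_, rfl⟩
    rw [show j - 1 - (m : ℤ) = k + 1 by lia] at ih
    rw [← hk]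
    have hne : c (k + 1) j ≠ 0 := (hR (k + 1) j (by lia) (by lia)).2
    have d1 := hd k j (by lia) (by lia)
    have d2 := hd k (j - 1) (by lia) (by lia)
    rw [show j - 1 + 1 = j by ring] at d2
    apply mul_left_cancel₀ hne
    linear_combination c k j * ih + d2 - d1

/-- The last non-trivial entry of a row is a quiddity entry. -/
theorem IsFrieze.last_eq_quiddity {K : Type*} [Field K] {R : Set K} {n : ℕ} {c : ℤ → ℤ → K}
    (hc : IsFrieze R n c) (k : ℤ) :
    c k (k + n + 1) = c (k + n + 1) (k + n + 3) := by
  have h := hc.add_eq_quiddity_mul (k + n + 2) (n + 1) le_rfl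
  have h2 := (hc.1 k).2.2.1
  have h3 := (hc.1 k).2.2.2
  rw [show (n : ℤ) + k + 2 = k + n + 2 by ring] at h2
  rw [show (n : ℤ) + k + 3 = k + n + 3 by ring] at h3
  rw [show k + n + 2 - 1 - ((n + 1 : ℕ) : ℤ) = k by push_cast; ring,
    show k + (n : ℤ) + 2 - 1 = k + n + 1 by ring,
    show k + (n : ℤ) + 2 + 1 = k + n + 3 by ring, h2, h3] at h
  simpa using h

theorem one_half_lt_abs_mul {x y : ℝ} (hx : 1 / Real.sqrt 2 < |x|) (hy : 1 / Real.sqrt 2 < |y|) :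
    1 / 2 < |x * y| := by
  have h : (1 / Real.sqrt 2) * (1 / Real.sqrt 2) = 1 / 2 := by
    rw [div_mul_div_comm, Real.mul_self_sqrt (by norm_num), one_mul]
  rw [abs_mul, ← h]
  exact mul_lt_mul'' hx hy (by positivity) (by positivity)

/-- If all entries of a real `2 × 2` matrix of determinant one exceed `1 / √2` in absolute value,
then the products along its two rows have the same sign. -/
theorem mul_pos_iff_of_det_eq_one {x y z w : ℝ} (hx : 1 / Real.sqrt 2 < |x|)
    (hy : 1 / Real.sqrt 2 < |y|) (hz : 1 / Real.sqrt 2 < |z|) (hw : 1 / Real.sqrt 2 < |w|)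
    (h : x * w - y * z = 1) : 0 < x * y ↔ 0 < z * w := by
  have h1 := one_half_lt_abs_mul hx hw
  have h2 := one_half_lt_abs_mul hy hz
  have hpos : 0 < (x * w) * (y * z) := by
    rcases lt_abs.1 h1 with h1 | h1 <;> rcases lt_abs.1 h2 with h2 | h2 <;> nlinarith
  rw [show (x * w) * (y * z) = (x * y) * (z * w) by ring] at hpos
  exact pos_iff_pos_of_mul_pos hpos

theorem IsFrieze.quiddity_pos_iff_mul_pos {n : ℕ} {c : ℤ → ℤ → ℝ}
    (hc : IsFrieze {x : ℝ | 1 / Real.sqrt 2 < |x|} n c) (j : ℤ) (m : ℕ) (hm : m ≤ n) :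
    0 < c (j - 1) (j + 1) ↔ 0 < c (j - 1 - m) j * c (j - 1 - m) (j + 1) := by
  obtain ⟨hb, hR, hd⟩ := hc
  induction m with
  | zero =>
    have h1 := (hb (j - 1)).2.1
    rw [show j - 1 + 1 = j by ring] at h1
    simp [h1]
  | succ m ih =>
    obtain ⟨k, hk⟩ : ∃ k : ℤ, k = j - 1 - (m + 1 : ℕ) := ⟨_, rfl⟩
    rw [ih (by lia), show j - 1 - (m : ℤ) = k + 1 by lia, ← hk]
    exact (mul_pos_iff_of_det_eq_one (hR k j (by lia) (by lia)).1
      (hR k (j + 1) (by lia) (by lia)).1 (hR (k + 1) j (by lia) (by lia)).1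
      (hR (k + 1) (j + 1) (by lia) (by lia)).1 (hd k j (by lia) (by lia))).symm

theorem IsFrieze.quiddity_pos_iff_succ {n : ℕ} {c : ℤ → ℤ → ℝ}
    (hc : IsFrieze {x : ℝ | 1 / Real.sqrt 2 < |x|} n c) (i : ℤ) :
    0 < c i (i + 2) ↔ 0 < c (i + 1) (i + 1 + 2) := by
  have h := hc.quiddity_pos_iff_mul_pos (i + 1) n le_rfl
  have hlast := hc.last_eq_quiddity (i - n)
  have hone := (hc.1 (i - n)).2.2.1
  rw [show (n : ℤ) + (i - n) + 2 = i + 2 by ring] at hone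
  rw [show i - (n : ℤ) + n + 1 = i + 1 by ring,
    show i - (n : ℤ) + n + 3 = i + 1 + 2 by ring] at hlast
  rwa [show i + 1 - 1 = i by ring, show i + 1 + 1 = i + 2 by ring, hone, hlast, mul_one] at h

theorem stmt17 (n : ℕ) (c : ℤ → ℤ → ℝ)
    (hc : IsFrieze {x : ℝ | 1 / Real.sqrt 2 < |x|} n c) :
    ∀ i i' : ℤ, (0 < c i (i + 2) ↔ 0 < c i' (i' + 2)) := by
  suffices h : ∀ i : ℤ, (0 < c i (i + 2) ↔ 0 < c 0 (0 + 2)) from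
    fun i i' => (h i).trans (h i').symm
  intro i
  induction i with
  | zero => rfl
  | succ i ih => exact (hc.quiddity_pos_iff_succ i).symm.trans ih
  | pred i ih =>
    have h := hc.quiddity_pos_iff_succ (-(i : ℤ) - 1)
    rw [show -(i : ℤ) - 1 + 1 = -i by ring] at h
    exact h.trans ih
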